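/- L = ℂ[x,y,z]. Equivalently, the coordinate ring ℂ[M] = ℂ[x,y,z]/(f) of the Markov-type surface M is generated, as a Lie algebra under the induced Poisson bracket, by the constant 1 together with the powers x^k, y^k, z^k (k ≥ 1). (This is the algebraic core of the Hamiltonian density property of the Markov-type surface M: the Hamiltonian functions of the complete vector fields f(x)V^x, f(y)V^y, f(z)V^z generate, under the Poisson bracket, a dense Lie algebra of Hamiltonian functions.) -/

import Mathlib

open MvPolynomial

/-- The defining polynomial `f = x² + y² + z² + Exyz − Ax − By − Cz − D` of the
Markov-type surface. -/
noncomputable def markovPoly (A B C D E : ℂ) : MvPolynomial (Fin 3) ℂ :=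
  X 0 ^ 2 + X 1 ^ 2 + X 2 ^ 2 + MvPolynomial.C E * X 0 * X 1 * X 2
    - MvPolynomial.C A * X 0 - MvPolynomial.C B * X 1 - MvPolynomial.C C * X 2
    - MvPolynomial.C D

/-- The Poisson bracket on `ℂ[x,y,z]` induced by the Markov-type surface:
`{g,h} = f_x·(g_y h_z − g_z h_y) + f_y·(g_z h_x − g_x h_z) + f_z·(g_x h_y − g_y h_x)`,
where `f` is the defining polynomial of the surface. -/
noncomputable def markovBracket (A B C D E : ℂ) (g h : MvPolynomial (Fin 3) ℂ) :
    MvPolynomial (Fin 3) ℂ :=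
  pderiv 0 (markovPoly A B C D E) * (pderiv 1 g * pderiv 2 h - pderiv 2 g * pderiv 1 h)
  + pderiv 1 (markovPoly A B C D E) * (pderiv 2 g * pderiv 0 h - pderiv 0 g * pderiv 2 h)
  + pderiv 2 (markovPoly A B C D E) * (pderiv 0 g * pderiv 1 h - pderiv 1 g * pderiv 0 h)

section MarkovBracket

variable {A B C D E : ℂ}

lemma pderiv_zero_markovPoly :
    pderiv 0 (markovPoly A B C D E)
      = 2 * X 0 + MvPolynomial.C E * X 1 * X 2 - MvPolynomial.C A := by
  simp [markovPoly, pderiv_X]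
  ring

lemma pderiv_one_markovPoly :
    pderiv 1 (markovPoly A B C D E)
      = 2 * X 1 + MvPolynomial.C E * X 0 * X 2 - MvPolynomial.C B := by
  simp [markovPoly, pderiv_X]
  ring

lemma pderiv_two_markovPoly :
    pderiv 2 (markovPoly A B C D E)
      = 2 * X 2 + MvPolynomial.C E * X 0 * X 1 - MvPolynomial.C C := by
  simp [markovPoly, pderiv_X]

lemma C_two : (MvPolynomial.C 2 : MvPolynomial (Fin 3) ℂ) = 2 :=
  map_ofNat MvPolynomial.C 2

lemma markovBracket_X_zero_pow_X_one_pow (a b : ℕ) :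
    markovBracket A B C D E (X 0 ^ (a + 1)) (X 1 ^ (b + 1))
      = MvPolynomial.C (((a + 1 : ℕ) : ℂ) * ((b + 1 : ℕ) : ℂ)) *
        (MvPolynomial.C E * (X 0 ^ (a + 1) * X 1 ^ (b + 1) * X 2 ^ 0)
          + MvPolynomial.C 2 * (X 0 ^ a * X 1 ^ b * X 2 ^ 1)
          - MvPolynomial.C C * (X 0 ^ a * X 1 ^ b * X 2 ^ 0)) := by
  rw [markovBracket, pderiv_two_markovPoly]
  simp [pderiv_X, C_two]
  ring

lemma markovBracket_X_one_pow_X_two_pow (b c : ℕ) :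
    markovBracket A B C D E (X 1 ^ (b + 1)) (X 2 ^ (c + 1))
      = MvPolynomial.C (((b + 1 : ℕ) : ℂ) * ((c + 1 : ℕ) : ℂ)) *
        (MvPolynomial.C E * (X 0 ^ 0 * X 1 ^ (b + 1) * X 2 ^ (c + 1))
          + MvPolynomial.C 2 * (X 0 ^ 1 * X 1 ^ b * X 2 ^ c)
          - MvPolynomial.C A * (X 0 ^ 0 * X 1 ^ b * X 2 ^ c)) := by
  rw [markovBracket, pderiv_zero_markovPoly]
  simp [pderiv_X, C_two]
  ring

lemma markovBracket_X_two_pow_X_zero_pow (a c : ℕ) :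
    markovBracket A B C D E (X 2 ^ (c + 1)) (X 0 ^ (a + 1))
      = MvPolynomial.C (((c + 1 : ℕ) : ℂ) * ((a + 1 : ℕ) : ℂ)) *
        (MvPolynomial.C E * (X 0 ^ (a + 1) * X 1 ^ 0 * X 2 ^ (c + 1))
          + MvPolynomial.C 2 * (X 0 ^ a * X 1 ^ 1 * X 2 ^ c)
          - MvPolynomial.C B * (X 0 ^ a * X 1 ^ 0 * X 2 ^ c)) := by
  rw [markovBracket, pderiv_one_markovPoly]
  simp [pderiv_X, C_two]
  ring

lemma C_mul_X_pow_succ_eq (a b c : ℕ) :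
    MvPolynomial.C E * (X 0 ^ (a + 1) * X 1 ^ (b + 1) * X 2 ^ (c + 1))
      = X 0 ^ a * X 1 ^ b * X 2 ^ c * markovPoly A B C D E
        - X 0 ^ (a + 2) * X 1 ^ b * X 2 ^ c
        - X 0 ^ a * X 1 ^ (b + 2) * X 2 ^ c
        - X 0 ^ a * X 1 ^ b * X 2 ^ (c + 2)
        + MvPolynomial.C A * (X 0 ^ (a + 1) * X 1 ^ b * X 2 ^ c)
        + MvPolynomial.C B * (X 0 ^ a * X 1 ^ (b + 1) * X 2 ^ c)
        + MvPolynomial.C C * (X 0 ^ a * X 1 ^ b * X 2 ^ (c + 1))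
        + MvPolynomial.C D * (X 0 ^ a * X 1 ^ b * X 2 ^ c) := by
  rw [markovPoly]
  ring

end MarkovBracket

lemma mem_of_C_mul_add_sub_mem {σ : Type*} {L : Submodule ℂ (MvPolynomial σ ℂ)}
    {k e r s : ℂ} (hk : k ≠ 0) (he : e ≠ 0) {p q t : MvPolynomial σ ℂ}
    (h : MvPolynomial.C k *
      (MvPolynomial.C e * p + MvPolynomial.C r * q - MvPolynomial.C s * t) ∈ L)
    (hq : q ∈ L) (ht : t ∈ L) : p ∈ L := by
  simp only [C_mul'] at h
  rw [L.smul_mem_iff hk, L.sub_mem_iff_left (L.smul_mem s ht),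
    L.add_mem_iff_left (L.smul_mem r hq), L.smul_mem_iff he] at h
  exact h

/-- `L = ℂ[x,y,z]`: the smallest ℂ-linear subspace of `ℂ[x,y,z]` containing the ideal
`(f)`, the constant `1` and all powers `x^m, y^m, z^m` (`m ≥ 1`), and closed under
the Poisson bracket, is all of `ℂ[x,y,z]`. Equivalently, the coordinate ring
`ℂ[M] = ℂ[x,y,z]/(f)` of the Markov-type surface is generated, as a Lie algebra under
the induced Poisson bracket, by `1` together with the powers `x^k, y^k, z^k` (`k ≥ 1`);
this is the algebraic core of the Hamiltonian density property of `M`. (Formalized by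
quantifying over all such subspaces `L`.) -/
theorem poisson_lie_algebra_generates (A B C D E : ℂ) (hE : E ≠ 0)
    (L : Submodule ℂ (MvPolynomial (Fin 3) ℂ))
    (hIdeal : ∀ p ∈ Ideal.span {markovPoly A B C D E}, p ∈ L)
    (hone : (1 : MvPolynomial (Fin 3) ℂ) ∈ L)
    (hxpow : ∀ m : ℕ, 1 ≤ m → (X 0 : MvPolynomial (Fin 3) ℂ) ^ m ∈ L)
    (hypow : ∀ m : ℕ, 1 ≤ m → (X 1 : MvPolynomial (Fin 3) ℂ) ^ m ∈ L)
    (hzpow : ∀ m : ℕ, 1 ≤ m → (X 2 : MvPolynomial (Fin 3) ℂ) ^ m ∈ L)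
    (hbr : ∀ g h : MvPolynomial (Fin 3) ℂ, g ∈ L → h ∈ L → markovBracket A B C D E g h ∈ L) :
    ∀ p : MvPolynomial (Fin 3) ℂ, p ∈ L := by
  have hk (m n : ℕ) : ((m + 1 : ℕ) : ℂ) * ((n + 1 : ℕ) : ℂ) ≠ 0 :=
    mul_ne_zero (Nat.cast_ne_zero.2 m.succ_ne_zero) (Nat.cast_ne_zero.2 n.succ_ne_zero)
  have hmon : ∀ n a b c : ℕ, a + b + c = n →
      (X 0 ^ a * X 1 ^ b * X 2 ^ c : MvPolynomial (Fin 3) ℂ) ∈ L := by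
    intro n
    induction n using Nat.strong_induction_on with
    | _ n ih =>
    have lower (a b c : ℕ) (h : a + b + c < n) :
        (X 0 ^ a * X 1 ^ b * X 2 ^ c : MvPolynomial (Fin 3) ℂ) ∈ L := ih _ h a b c rfl
    rintro (_ | a) (_ | b) (_ | c) habc
    · simpa using hone
    · simpa using hzpow (c + 1) c.succ_pos
    · simpa using hypow (b + 1) b.succ_pos
    · have h := hbr _ _ (hypow (b + 1) b.succ_pos) (hzpow (c + 1) c.succ_pos)
      rw [markovBracket_X_one_pow_X_two_pow] at h
      exact mem_of_C_mul_add_sub_mem (hk b c) hE h (lower _ _ _ (by lia)) (lower _ _ _ (by lia))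
    · simpa using hxpow (a + 1) a.succ_pos
    · have h := hbr _ _ (hzpow (c + 1) c.succ_pos) (hxpow (a + 1) a.succ_pos)
      rw [markovBracket_X_two_pow_X_zero_pow] at h
      exact mem_of_C_mul_add_sub_mem (hk c a) hE h (lower _ _ _ (by lia)) (lower _ _ _ (by lia))
    · have h := hbr _ _ (hxpow (a + 1) a.succ_pos) (hypow (b + 1) b.succ_pos)
      rw [markovBracket_X_zero_pow_X_one_pow] at h
      exact mem_of_C_mul_add_sub_mem (hk a b) hE h (lower _ _ _ (by lia)) (lower _ _ _ (by lia))
    · rw [← L.smul_mem_iff hE, ← C_mul', C_mul_X_pow_succ_eq (A := A) (B := B) (C := C) (D := D)]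
      have hf := hIdeal _ (Ideal.mul_mem_left _ (X 0 ^ a * X 1 ^ b * X 2 ^ c)
        (Ideal.mem_span_singleton_self (markovPoly A B C D E)))
      have hsmul (r : ℂ) (i j k : ℕ) (h : i + j + k < n) :
          MvPolynomial.C r * (X 0 ^ i * X 1 ^ j * X 2 ^ k : MvPolynomial (Fin 3) ℂ) ∈ L := by
        rw [C_mul']
        exact L.smul_mem r (lower i j k h)
      refine L.add_mem (L.add_mem (L.add_mem (L.add_mem (L.sub_mem (L.sub_mem (L.sub_mem hf
        ?_) ?_) ?_) ?_) ?_) ?_) ?_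
      · exact lower _ _ _ (by lia)
      · exact lower _ _ _ (by lia)
      · exact lower _ _ _ (by lia)
      · exact hsmul _ _ _ _ (by lia)
      · exact hsmul _ _ _ _ (by lia)
      · exact hsmul _ _ _ _ (by lia)
      · exact hsmul _ _ _ _ (by lia)
  intro p
  induction p using MvPolynomial.induction_on' with
  | monomial s r =>
    rw [monomial_eq, C_mul', Finsupp.prod_fintype _ _ (by simp), Fin.prod_univ_three]
    exact L.smul_mem r (hmon _ _ _ _ rfl)
  | add p q hp hq => exact L.add_mem hp hq
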